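/- arXiv:1806.07204 — 3 statements merged into one kernel-verified Lean document; each statement's English description precedes it below -/
import Mathlib

section
/- Let D be a finite kernel-perfect digraph with underlying undirected graph H. If L is a list assignment for the vertices of H such that |L(v)| ≥ d⁺(v) + 1 for every vertex v, where d⁺(v) is the out-degree of v in D, then H is L-colorable. -/
open Finset

/-- The set `A` has a kernel with respect to the arc relation `D`: an independent subset
`K ⊆ A` such that every vertex of `A` outside `K` has an out-neighbor in `K`. -/
def HasKernelOn {V : Type*} (D : V → V → Prop) (A : Set V) : Prop :=
  ∃ K ⊆ A, (∀ u ∈ K, ∀ v ∈ K, ¬ D u v) ∧ ∀ v ∈ A, v ∉ K → ∃ u ∈ K, D v u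

open Classical in
theorem kernel_aux {V : Type} (D : V → V → Prop) (hKP : ∀ A : Set V, HasKernelOn D A)
    (S : Finset V) : ∀ L : V → Finset ℕ,
    (∀ v ∈ S, (S.filter fun w => D v w).card + 1 ≤ (L v).card) →
    ∃ φ : V → ℕ, (∀ v ∈ S, φ v ∈ L v) ∧ ∀ u ∈ S, ∀ v ∈ S, D u v → φ u ≠ φ v := by
  induction S using Finset.strongInduction with
  | H S ih =>
    intro L hL
    rcases S.eq_empty_or_nonempty with rfl | ⟨v0, hv0⟩
    · exact ⟨fun _ => 0, by simp, by simp⟩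
    have hne : (L v0).Nonempty := by
      have := hL v0 hv0
      exact Finset.card_pos.mp (by omega)
    obtain ⟨c, hc⟩ := hne
    obtain ⟨K, hKA, hind, hker⟩ := hKP {v | v ∈ S ∧ c ∈ L v}
    have hKne : ∃ k, k ∈ K := by
      by_cases h : v0 ∈ K
      · exact ⟨v0, h⟩
      · obtain ⟨u, hu, _⟩ := hker v0 ⟨hv0, hc⟩ h
        exact ⟨u, hu⟩
    obtain ⟨k, hk⟩ := hKne
    have hsub : S.filter (fun v => v ∉ K) ⊂ S := by
      rw [Finset.filter_ssubset]
      exact ⟨k, (hKA hk).1, by simpa using hk⟩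
    obtain ⟨φ, h1, h2⟩ := ih _ hsub (fun v => (L v).erase c) (by
      intro v hv
      obtain ⟨hvS, hvK⟩ := Finset.mem_filter.mp hv
      have hLv := hL v hvS
      have hss : ((S.filter (fun v => v ∉ K)).filter fun w => D v w) ⊆
          S.filter fun w => D v w := Finset.filter_subset_filter _ (Finset.filter_subset _ _)
      by_cases hcv : c ∈ L v
      · obtain ⟨u, hu, hvu⟩ := hker v ⟨hvS, hcv⟩ hvK
        have hlt := Finset.card_lt_card (Finset.ssubset_iff_subset_ne.mpr ⟨hss, fun he => by
          have hm : u ∈ S.filter fun w => D v w := Finset.mem_filter.mpr ⟨(hKA hu).1, hvu⟩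
          rw [← he] at hm
          exact (Finset.mem_filter.mp (Finset.mem_filter.mp hm).1).2 hu⟩)
        rw [Finset.card_erase_of_mem hcv]
        omega
      · rw [Finset.erase_eq_of_notMem hcv]
        have := Finset.card_le_card hss
        omega)
    have h1' : ∀ v ∈ S, v ∉ K → φ v ≠ c ∧ φ v ∈ L v := fun v hv hvK =>
      Finset.mem_erase.mp (h1 v (Finset.mem_filter.mpr ⟨hv, hvK⟩))
    refine ⟨fun v => if v ∈ K then c else φ v, ?_, ?_⟩
    · intro v hv
      by_cases h : v ∈ K
      · simpa [h] using (hKA h).2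
      · simpa [h] using (h1' v hv h).2
    · intro u hu v hv huv
      by_cases h : u ∈ K <;> by_cases h' : v ∈ K
      · exact absurd huv (hind u h v h')
      · simpa [h, h'] using (h1' v hv h').1.symm
      · simpa [h, h'] using (h1' u hu h).1
      · simpa [h, h'] using h2 u (Finset.mem_filter.mpr ⟨hu, h⟩) v
          (Finset.mem_filter.mpr ⟨hv, h'⟩) huv

/-- Bondy–Boppana–Siegel: if `D` is a finite kernel-perfect digraph with underlying graph `H`
and `L` is a list assignment with `|L(v)| ≥ d⁺(v) + 1` for every vertex `v`, then `H` is
`L`-colorable. -/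
theorem kernel_perfect_list_coloring {V : Type} [Fintype V] (D : V → V → Prop)
    [DecidableRel D] (hKP : ∀ A : Set V, HasKernelOn D A)
    (H : SimpleGraph V) (hH : ∀ u v : V, H.Adj u v ↔ u ≠ v ∧ (D u v ∨ D v u))
    (L : V → Finset ℕ)
    (hL : ∀ v : V, (Finset.univ.filter fun w => D v w).card + 1 ≤ (L v).card) :
    ∃ φ : V → ℕ, (∀ v, φ v ∈ L v) ∧ ∀ ⦃u v⦄, H.Adj u v → φ u ≠ φ v := by
  obtain ⟨φ, h1, h2⟩ := kernel_aux D hKP Finset.univ L (fun v _ => by convert hL v)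
  refine ⟨φ, fun v => h1 v (Finset.mem_univ v), fun u v huv => ?_⟩
  rcases ((hH u v).mp huv).2 with h | h
  · exact h2 u (Finset.mem_univ u) v (Finset.mem_univ v) h
  · exact (h2 v (Finset.mem_univ v) u (Finset.mem_univ u) h).symm
end

section
/- Let H be a finite simple graph whose vertex set is covered by two disjoint cliques B₁ and B₂, let L be a list assignment for V(H), and let T₁ ⊆ B₁ and T₂ ⊆ B₂. Suppose: (1) |B₁| ≥ 52811 and |B₂| ≥ 52811; (2) |T₁| ≤ 4400 and |T₂| ≤ 4400; (3) every vertex v ∈ Bᵢ has at most 11 neighbors in B_{3−i} (for i = 1, 2); (4) |L(v)| ≥ |Bᵢ| − 44 for every v ∈ Tᵢ; and (5) |L(v)| ≥ |Bᵢ| for every v ∈ Bᵢ \ Tᵢ. Then H is L-colorable. -/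
open Finset

/-- Galvin / Bondy–Boppana–Siegel kernel lemma. -/
theorem kernel_list_coloring {V : Type} [DecidableEq V] (H : SimpleGraph V)
    (D : V → V → Prop) [DecidableRel D]
    (hker : ∀ A : Finset V, A.Nonempty → ∃ K ⊆ A, K.Nonempty ∧
      (∀ u ∈ K, ∀ v ∈ K, ¬ H.Adj u v) ∧ ∀ v ∈ A, v ∉ K → ∃ u ∈ K, D v u) :
    ∀ (n : ℕ) (A : Finset V) (L : V → Finset ℕ), A.card = n →
      (∀ v ∈ A, (A.filter (D v)).card < (L v).card) →
      ∃ φ : V → ℕ, (∀ v ∈ A, φ v ∈ L v) ∧ ∀ u ∈ A, ∀ v ∈ A, H.Adj u v → φ u ≠ φ v := by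
  intro n
  induction n using Nat.strong_induction_on with
  | _ n ih =>
  intro A L hn hL
  rcases A.eq_empty_or_nonempty with rfl | ⟨v0, hv0⟩
  · exact ⟨fun _ => 0, by simp, by simp⟩
  obtain ⟨c, hc⟩ : (L v0).Nonempty := by
    rw [← Finset.card_pos]; exact lt_of_le_of_lt (Nat.zero_le _) (hL v0 hv0)
  obtain ⟨K, hKA, hKne, hKind, hKabs⟩ := hker (A.filter (fun v => c ∈ L v))
    ⟨v0, by simp [hv0, hc]⟩
  have hKA' : K ⊆ A := fun v hv => (Finset.mem_filter.1 (hKA hv)).1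
  have hcard : (A \ K).card < n := by
    rw [← hn]
    apply Finset.card_lt_card
    rw [Finset.ssubset_iff_subset_ne]
    refine ⟨Finset.sdiff_subset, fun h => ?_⟩
    obtain ⟨k, hk⟩ := hKne
    have := hKA' hk
    rw [← h] at this
    exact (Finset.mem_sdiff.1 this).2 hk
  obtain ⟨ψ, hψ1, hψ2⟩ := ih _ hcard (A \ K) (fun v => (L v).erase c) rfl (by
    intro v hv
    obtain ⟨hvA, hvK⟩ := Finset.mem_sdiff.1 hv
    by_cases hcv : c ∈ L v
    · obtain ⟨u, huK, hu⟩ := hKabs v (by simp [hvA, hcv]) hvK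
      have h1 : ((A \ K).filter (D v)).card < (A.filter (D v)).card := by
        apply Finset.card_lt_card
        refine ⟨Finset.filter_subset_filter _ Finset.sdiff_subset, fun h => ?_⟩
        have := h (Finset.mem_filter.2 ⟨hKA' huK, hu⟩)
        simp [huK] at this
      have h2 := hL v hvA
      have h3 := Finset.card_erase_of_mem hcv
      omega
    · simp only [Finset.erase_eq_of_notMem hcv]
      exact lt_of_le_of_lt (Finset.card_le_card
        (Finset.filter_subset_filter _ Finset.sdiff_subset)) (hL v hvA))
  refine ⟨fun v => if v ∈ K then c else ψ v, ?_, ?_⟩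
  · intro v hv
    by_cases h : v ∈ K
    · simpa [h] using (Finset.mem_filter.1 (hKA h)).2
    · simpa [h] using Finset.mem_of_mem_erase (hψ1 v (by simp [hv, h]))
  · intro u hu v hv huv
    by_cases h : u ∈ K <;> by_cases h' : v ∈ K
    · exact absurd huv (hKind u h v h')
    · simpa [h, h'] using (Finset.ne_of_mem_erase (hψ1 v (by simp [hv, h']))).symm
    · simpa [h, h'] using (Finset.ne_of_mem_erase (hψ1 u (by simp [hu, h])))
    · simpa [h, h'] using hψ2 u (by simp [hu, h]) v (by simp [hv, h']) huv

theorem pair_kernel {V : Type} [DecidableEq V] (H : SimpleGraph V)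
    (p s : V → Prop) (r : V → ℕ) (hr : Function.Injective r)
    (hadj : ∀ u v, (p u ↔ p v) → u ≠ v → H.Adj u v)
    (A : Finset V) (x y : V) (hx : x ∈ A) (hy : y ∈ A) (px : p x) (py : ¬ p y)
    (hxy : ¬ H.Adj x y)
    (h1 : ∀ x' ∈ A, p x' → r x' < r x → H.Adj x' y ∧ ¬ s x')
    (h2 : ∀ y' ∈ A, ¬ p y' → r y' < r y → H.Adj x y' ∧ ¬ s y') :
    ∃ K ⊆ A, K.Nonempty ∧
      (∀ u ∈ K, ∀ v ∈ K, ¬ H.Adj u v) ∧ ∀ v ∈ A, v ∉ K → ∃ u ∈ K,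
        (H.Adj v u ∧ ((p v ↔ p u) → r u < r v) ∧ (¬ (p v ↔ p u) → ¬ s v)) := by
  refine ⟨{x, y}, ?_, ⟨x, by simp⟩, ?_, ?_⟩
  · intro z hz
    simp only [Finset.mem_insert, Finset.mem_singleton] at hz
    rcases hz with rfl | rfl <;> assumption
  · intro u hu v hv
    simp only [Finset.mem_insert, Finset.mem_singleton] at hu hv
    rcases hu with rfl | rfl <;> rcases hv with rfl | rfl
    · exact H.irrefl
    · exact hxy
    · exact fun h => hxy h.symm
    · exact H.irrefl
  · intro v hv hvK
    simp only [Finset.mem_insert, Finset.mem_singleton, not_or] at hvK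
    obtain ⟨hvx, hvy⟩ := hvK
    by_cases pv : p v
    · rcases lt_or_ge (r v) (r x) with h | h
      · exact ⟨y, by simp, (h1 v hv pv h).1, by tauto, fun _ => (h1 v hv pv h).2⟩
      · have : r x ≠ r v := fun h => hvx (hr h).symm
        exact ⟨x, by simp, hadj _ _ (by tauto) hvx, fun _ => by omega, by tauto⟩
    · rcases lt_or_ge (r v) (r y) with h | h
      · exact ⟨x, by simp, (h2 v hv pv h).1.symm, by tauto, fun _ => (h2 v hv pv h).2⟩
      · have : r y ≠ r v := fun h => hvy (hr h).symm
        exact ⟨y, by simp, hadj _ _ (by tauto) hvy, fun _ => by omega, by tauto⟩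

theorem single_kernel {V : Type} [DecidableEq V] (H : SimpleGraph V)
    (p s : V → Prop) (r : V → ℕ) (hr : Function.Injective r)
    (hadj : ∀ u v, (p u ↔ p v) → u ≠ v → H.Adj u v)
    (A : Finset V) (x : V) (hx : x ∈ A)
    (h1 : ∀ x' ∈ A, (p x' ↔ p x) → r x ≤ r x')
    (h2 : ∀ y ∈ A, ¬ (p y ↔ p x) → H.Adj y x ∧ ¬ s y) :
    ∃ K ⊆ A, K.Nonempty ∧
      (∀ u ∈ K, ∀ v ∈ K, ¬ H.Adj u v) ∧ ∀ v ∈ A, v ∉ K → ∃ u ∈ K,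
        (H.Adj v u ∧ ((p v ↔ p u) → r u < r v) ∧ (¬ (p v ↔ p u) → ¬ s v)) := by
  refine ⟨{x}, by simpa using hx, ⟨x, by simp⟩, by simp, ?_⟩
  intro v hv hvx
  simp only [Finset.mem_singleton] at hvx
  refine ⟨x, by simp, ?_⟩
  by_cases h : p v ↔ p x
  · have h3 : r x ≠ r v := fun h => hvx (hr h).symm
    have := h1 v hv h
    exact ⟨hadj _ _ h hvx, fun _ => by omega, by tauto⟩
  · exact ⟨(h2 v hv h).1, by tauto, fun _ => (h2 v hv h).2⟩

theorem exists_kernel {V : Type} [DecidableEq V] (H : SimpleGraph V)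
    (p s : V → Prop) (r : V → ℕ) (hr : Function.Injective r)
    (hadj : ∀ u v, (p u ↔ p v) → u ≠ v → H.Adj u v)
    (hs : ∀ u v, s u → s v → ¬ (p u ↔ p v) → ¬ H.Adj u v)
    (hrs : ∀ u v, s u → ¬ s v → r v < r u)
    (A : Finset V) (hA : A.Nonempty) :
    ∃ K ⊆ A, K.Nonempty ∧
      (∀ u ∈ K, ∀ v ∈ K, ¬ H.Adj u v) ∧ ∀ v ∈ A, v ∉ K → ∃ u ∈ K,
        (H.Adj v u ∧ ((p v ↔ p u) → r u < r v) ∧ (¬ (p v ↔ p u) → ¬ s v)) := by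
  classical
  have hmin : ∀ q : V → Prop, (∃ x ∈ A, q x) →
      ∃ x ∈ A, q x ∧ ∀ x' ∈ A, q x' → r x ≤ r x' := by
    rintro q ⟨x, hx, hq⟩
    obtain ⟨m, hm, hm'⟩ := Finset.exists_min_image (A.filter q) r ⟨x, by simp [hx, hq]⟩
    simp only [Finset.mem_filter] at hm hm'
    exact ⟨m, hm.1, hm.2, fun x' h1 h2 => hm' x' ⟨h1, h2⟩⟩
  by_cases h00 : ∃ x ∈ A, ∃ y ∈ A, p x ∧ ¬ p y ∧ ¬ s x ∧ ¬ s y ∧ ¬ H.Adj x y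
  · obtain ⟨x0, hx0, y0, hy0, h0⟩ := h00
    obtain ⟨⟨x, y⟩, hm, hm'⟩ := Finset.exists_min_image
      ((A ×ˢ A).filter (fun z => p z.1 ∧ ¬ p z.2 ∧ ¬ s z.1 ∧ ¬ s z.2 ∧ ¬ H.Adj z.1 z.2))
      (fun z => r z.1 + r z.2) ⟨(x0, y0), by simp [hx0, hy0, h0]⟩
    simp only [Finset.mem_filter, Finset.mem_product, Prod.forall] at hm hm'
    obtain ⟨⟨hx, hy⟩, px, py, sx, sy, hxy⟩ := hm
    refine pair_kernel H p s r hr hadj A x y hx hy px py hxy ?_ ?_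
    · intro x' hx' px' hlt
      have sx' : ¬ s x' := fun h => by have := hrs _ _ h sx; omega
      refine ⟨?_, sx'⟩
      by_contra hn
      have := hm' x' y ⟨⟨hx', hy⟩, px', py, sx', sy, hn⟩
      omega
    · intro y' hy' py' hlt
      have sy' : ¬ s y' := fun h => by have := hrs _ _ h sy; omega
      refine ⟨?_, sy'⟩
      by_contra hn
      have := hm' x y' ⟨⟨hx, hy'⟩, px, py', sx, sy', hn⟩
      omega
  push Not at h00
  by_cases hP : ∃ x ∈ A, p x
  swap
  · obtain ⟨x, hx, -, h⟩ := hmin (fun _ => True) (by obtain ⟨x, hx⟩ := hA; exact ⟨x, hx, trivial⟩)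
    push Not at hP
    exact single_kernel H p s r hr hadj A x hx (fun x' h' _ => h x' h' trivial)
      (fun y hy hn => absurd (iff_of_false (hP y hy) (hP x hx)) hn)
  by_cases hQ : ∃ x ∈ A, ¬ p x
  swap
  · obtain ⟨x, hx, -, h⟩ := hmin (fun _ => True) (by obtain ⟨x, hx⟩ := hA; exact ⟨x, hx, trivial⟩)
    push Not at hQ
    exact single_kernel H p s r hr hadj A x hx (fun x' h' _ => h x' h' trivial)
      (fun y hy hn => absurd (iff_of_true (hQ y hy) (hQ x hx)) hn)
  obtain ⟨a, ha, pa, hamin⟩ := hmin _ hP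
  obtain ⟨b, hb, pb, hbmin⟩ := hmin _ hQ
  by_cases hS2 : ∃ y ∈ A, ¬ p y ∧ s y
  · obtain ⟨t, ht, ⟨pt, st⟩, htmin⟩ := hmin _ hS2
    by_cases h01 : ∃ x ∈ A, p x ∧ ¬ s x ∧ ¬ H.Adj x t
    · obtain ⟨x, hx, ⟨px, sx, hxt⟩, hxmin⟩ := hmin _ h01
      refine pair_kernel H p s r hr hadj A x t hx ht px pt hxt ?_ ?_
      · intro x' hx' px' hlt
        have sx' : ¬ s x' := fun h => by have := hrs _ _ h sx; omega
        refine ⟨?_, sx'⟩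
        by_contra hn
        have := hxmin x' hx' ⟨px', sx', hn⟩
        omega
      · intro y' hy' py' hlt
        have sy' : ¬ s y' := fun h => by have := htmin y' hy' ⟨py', h⟩; omega
        exact ⟨h00 x hx y' hy' px py' sx sy', sy'⟩
    · push Not at h01
      by_cases hS1 : ∃ x ∈ A, p x ∧ s x
      · obtain ⟨σ, hσ, ⟨pσ, sσ⟩, hσmin⟩ := hmin _ hS1
        obtain ⟨y, hy, ⟨py, hσy⟩, hymin⟩ := hmin (fun y => ¬ p y ∧ ¬ H.Adj σ y)
          ⟨t, ht, pt, hs _ _ sσ st (by tauto)⟩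
        have hyt : r y ≤ r t := hymin t ht ⟨pt, hs _ _ sσ st (by tauto)⟩
        refine pair_kernel H p s r hr hadj A σ y hσ hy pσ py hσy ?_ ?_
        · intro x' hx' px' hlt
          have sx' : ¬ s x' := fun h => by have := hσmin x' hx' ⟨px', h⟩; omega
          refine ⟨?_, sx'⟩
          by_cases sy : s y
          · have h3 := htmin y hy ⟨py, sy⟩
            have : y = t := hr (by omega)
            rw [this]; exact h01 x' hx' px' sx'
          · exact h00 x' hx' y hy px' py sx' sy
        · intro y' hy' py' hlt
          have sy' : ¬ s y' := fun h => by have := htmin y' hy' ⟨py', h⟩; omega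
          refine ⟨?_, sy'⟩
          by_contra hn
          have := hymin y' hy' ⟨py', hn⟩
          omega
      · push Not at hS1
        refine single_kernel H p s r hr hadj A b hb (fun x' h' h => hbmin x' h' (by tauto)) ?_
        intro y hy hn
        have py : p y := by tauto
        have sy := hS1 y hy py
        refine ⟨?_, sy⟩
        by_cases sb : s b
        · have h3 := htmin b hb ⟨pb, sb⟩
          have h4 := hbmin t ht pt
          have : b = t := hr (by omega)
          rw [this]; exact h01 y hy py sy
        · exact h00 y hy b hb py pb sy sb
  · push Not at hS2
    by_cases h : ∃ y ∈ A, ¬ p y ∧ ¬ H.Adj a y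
    · skip
      obtain ⟨y0, hy0, py0, hay0⟩ := h
      have sa : s a := by
        by_contra sa
        exact hay0 (h00 a ha y0 hy0 pa py0 sa (hS2 y0 hy0 py0))
      obtain ⟨y, hy, ⟨py, hay⟩, hymin⟩ := hmin (fun y => ¬ p y ∧ ¬ H.Adj a y) ⟨y0, hy0, py0, hay0⟩
      refine pair_kernel H p s r hr hadj A a y ha hy pa py hay ?_ ?_
      · intro x' hx' px' hlt
        have := hamin x' hx' px'
        omega
      · intro y' hy' py' hlt
        refine ⟨?_, hS2 y' hy' py'⟩
        by_contra hn
        have := hymin y' hy' ⟨py', hn⟩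
        omega
    · push Not at h
      refine single_kernel H p s r hr hadj A a ha (fun x' h' hp => hamin x' h' (by tauto)) ?_
      intro y hy hn
      have py : ¬ p y := by tauto
      exact ⟨(h y hy py).symm, hS2 y hy py⟩

/-- Out-degree count on one clique. -/
theorem outdeg_bound {V : Type} [Fintype V] [DecidableEq V]
    (H : SimpleGraph V) [DecidableRel H.Adj] (B C T S : Finset V) (l : ℕ)
    (r : V → ℕ) (D : V → V → Prop) [DecidableRel D] (v : V)
    (hSB : S ⊆ B) (hS : S.card = 11) (hv : v ∈ B)
    (hB : 52811 ≤ B.card) (hT : T.card ≤ 4400)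
    (hcov : ∀ u, u ∈ B ∨ u ∈ C)
    (hdeg : (C.filter (H.Adj v)).card ≤ 11)
    (hDB : ∀ u ∈ B, D v u → r u < r v)
    (hDC : ∀ u ∈ C, D v u → H.Adj v u ∧ v ∉ S)
    (hrT : v ∈ T → ∀ u ∈ B, u ∉ T → r v < r u)
    (hrS : v ∉ S → ∀ u ∈ S, r v < r u)
    (hlT : v ∈ T → B.card - 44 ≤ l) (hl : v ∈ B \ T → B.card ≤ l)
    (hST : Disjoint S T) :
    ((Finset.univ : Finset V).filter (D v)).card < l := by
  have hsub : (Finset.univ : Finset V).filter (D v) ⊆ B.filter (D v) ∪ C.filter (D v) := by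
    intro u hu
    simp only [Finset.mem_filter, Finset.mem_univ, true_and, Finset.mem_union] at hu ⊢
    rcases hcov u with h | h <;> tauto
  have h1 := (Finset.card_le_card hsub).trans (Finset.card_union_le _ _)
  have h2 : (C.filter (D v)).card ≤ 11 := by
    refine le_trans (Finset.card_le_card ?_) hdeg
    intro u hu
    simp only [Finset.mem_filter] at hu ⊢
    exact ⟨hu.1, (hDC u hu.1 hu.2).1⟩
  by_cases hvS : v ∈ S
  · have h3 : C.filter (D v) = ∅ := by
      rw [Finset.filter_eq_empty_iff]
      intro u hu hD
      exact (hDC u hu hD).2 hvS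
    have h4 : (B.filter (D v)).card ≤ (B.erase v).card := by
      apply Finset.card_le_card
      intro u hu
      simp only [Finset.mem_filter, Finset.mem_erase] at hu ⊢
      refine ⟨?_, hu.1⟩
      rintro rfl
      exact lt_irrefl _ (hDB _ hu.1 hu.2)
    rw [Finset.card_erase_of_mem hv] at h4
    have := hl (Finset.mem_sdiff.2 ⟨hv, Finset.disjoint_left.1 hST hvS⟩)
    rw [h3, Finset.card_empty] at h1
    omega
  · by_cases hvT : v ∈ T
    · have h4 : (B.filter (D v)).card ≤ T.card := by
        apply Finset.card_le_card
        intro u hu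
        simp only [Finset.mem_filter] at hu
        by_contra hn
        have := hrT hvT u hu.1 hn
        have := hDB u hu.1 hu.2
        omega
      have := hlT hvT
      omega
    · have h4 : (B.filter (D v)).card ≤ ((B \ S).erase v).card := by
        apply Finset.card_le_card
        intro u hu
        simp only [Finset.mem_filter, Finset.mem_erase, Finset.mem_sdiff] at hu ⊢
        have h := hDB u hu.1 hu.2
        refine ⟨?_, hu.1, ?_⟩
        · rintro rfl
          exact lt_irrefl _ h
        · intro huS
          have := hrS hvS u huS
          omega
      rw [Finset.card_erase_of_mem (by simp [hv, hvS]), Finset.card_sdiff_of_subset hSB] at h4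
      have := hl (Finset.mem_sdiff.2 ⟨hv, hvT⟩)
      omega


/-- Two-cliques list-coloring lemma: let `H` be covered by two disjoint cliques `B₁, B₂` with
`|B₁|, |B₂| ≥ 52811`, each vertex of one clique having at most 11 neighbors in the other,
and let `T₁ ⊆ B₁`, `T₂ ⊆ B₂` with `|T₁|, |T₂| ≤ 4400`.  If each `v ∈ Tᵢ` has a list of at
least `|Bᵢ| − 44` colors and each `v ∈ Bᵢ \ Tᵢ` a list of at least `|Bᵢ|` colors, then `H`
is `L`-colorable. -/
theorem two_cliques_list_coloring {V : Type} [Fintype V] [DecidableEq V]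
    (H : SimpleGraph V) [DecidableRel H.Adj] (B₁ B₂ T₁ T₂ : Finset V) (L : V → Finset ℕ)
    (hdisj : Disjoint B₁ B₂) (hcover : ∀ v : V, v ∈ B₁ ∪ B₂)
    (hclique1 : H.IsClique ↑B₁) (hclique2 : H.IsClique ↑B₂)
    (hT1 : T₁ ⊆ B₁) (hT2 : T₂ ⊆ B₂)
    (hB1 : 52811 ≤ B₁.card) (hB2 : 52811 ≤ B₂.card)
    (hT1c : T₁.card ≤ 4400) (hT2c : T₂.card ≤ 4400)
    (hdeg1 : ∀ v ∈ B₁, (B₂.filter (H.Adj v)).card ≤ 11)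
    (hdeg2 : ∀ v ∈ B₂, (B₁.filter (H.Adj v)).card ≤ 11)
    (hLT1 : ∀ v ∈ T₁, B₁.card - 44 ≤ (L v).card)
    (hLT2 : ∀ v ∈ T₂, B₂.card - 44 ≤ (L v).card)
    (hL1 : ∀ v ∈ B₁ \ T₁, B₁.card ≤ (L v).card)
    (hL2 : ∀ v ∈ B₂ \ T₂, B₂.card ≤ (L v).card) :
    ∃ φ : V → ℕ, (∀ v, φ v ∈ L v) ∧ ∀ ⦃u v⦄, H.Adj u v → φ u ≠ φ v := by
  classical
  obtain ⟨S₁, hS1, hS1c⟩ : ∃ S ⊆ B₁ \ T₁, S.card = 11 := by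
    apply Finset.exists_subset_card_eq
    rw [Finset.card_sdiff_of_subset hT1]; omega
  have hS1B : S₁ ⊆ B₁ := hS1.trans Finset.sdiff_subset
  obtain ⟨S₂, hS2, hS2c⟩ : ∃ S ⊆ (B₂ \ T₂) \ S₁.biUnion (fun v => B₂.filter (H.Adj v)),
      S.card = 11 := by
    apply Finset.exists_subset_card_eq
    have h1 : (S₁.biUnion (fun v => B₂.filter (H.Adj v))).card ≤ S₁.card * 11 :=
      Finset.card_biUnion_le_card_mul _ _ _ (fun v hv => hdeg1 v (hS1B hv))
    have h2 := Finset.le_card_sdiff (S₁.biUnion (fun v => B₂.filter (H.Adj v))) (B₂ \ T₂)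
    rw [Finset.card_sdiff_of_subset hT2] at h2
    omega
  have hS2' : S₂ ⊆ B₂ \ T₂ := hS2.trans Finset.sdiff_subset
  have hS2B : S₂ ⊆ B₂ := hS2'.trans Finset.sdiff_subset
  have hST1 : Disjoint S₁ T₁ := Finset.disjoint_left.2 fun v hv => (Finset.mem_sdiff.1 (hS1 hv)).2
  have hST2 : Disjoint S₂ T₂ := Finset.disjoint_left.2 fun v hv => (Finset.mem_sdiff.1 (hS2' hv)).2
  have hSS : ∀ u ∈ S₁, ∀ v ∈ S₂, ¬ H.Adj u v := by
    intro u hu v hv h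
    exact (Finset.mem_sdiff.1 (hS2 hv)).2
      (Finset.mem_biUnion.2 ⟨u, hu, Finset.mem_filter.2 ⟨hS2B hv, h⟩⟩)
  have hd : ∀ v, v ∈ B₁ → v ∉ B₂ := fun v hv => Finset.disjoint_left.1 hdisj hv
  have hcov : ∀ v, v ∈ B₁ ∨ v ∈ B₂ := fun v => Finset.mem_union.1 (hcover v)
  have hp2 : ∀ v, v ∉ B₁ ↔ v ∈ B₂ := fun v =>
    ⟨fun h => (hcov v).resolve_left h, fun h h' => hd v h' h⟩
  let e := Fintype.equivFin V
  let N := Fintype.card V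
  let k : V → ℕ := fun v => if v ∈ T₁ ∪ T₂ then 0 else if v ∈ S₁ ∪ S₂ then 2 else 1
  let r : V → ℕ := fun v => k v * N + (e v : ℕ)
  have he : ∀ v, (e v : ℕ) < N := fun v => (e v).2
  have hrk : ∀ u v, k u < k v → r u < r v := by
    intro u v h
    have h1 : (k u + 1) * N ≤ k v * N := Nat.mul_le_mul_right _ h
    have h2 := he u
    simp only [r]
    rw [Nat.add_mul] at h1
    omega
  have hr : Function.Injective r := by
    intro u v h
    rcases lt_trichotomy (k u) (k v) with h1 | h1 | h1
    · have := hrk u v h1; omega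
    · simp only [r, h1] at h
      exact e.injective (Fin.ext (by omega))
    · have := hrk v u h1; omega
  have hkT : ∀ v, v ∈ T₁ ∪ T₂ → k v = 0 := fun v h => by simp only [k, h, if_true]
  have hkT' : ∀ v, v ∉ T₁ ∪ T₂ → 0 < k v := fun v h => by
    simp only [k, h, if_false]; split_ifs <;> omega
  have hkS' : ∀ v, v ∉ S₁ ∪ S₂ → k v < 2 := fun v h => by
    simp only [k, h, if_false]; split_ifs <;> omega
  have hkS : ∀ v, v ∈ S₁ ∪ S₂ → k v = 2 := fun v h => by
    have : v ∉ T₁ ∪ T₂ := by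
      rw [Finset.mem_union] at h ⊢
      rintro (ht | ht) <;> rcases h with h | h
      · exact (Finset.mem_sdiff.1 (hS1 h)).2 ht
      · exact hd v (hT1 ht) (hS2B h)
      · exact hd v (hS1B h) (hT2 ht)
      · exact (Finset.mem_sdiff.1 (hS2' h)).2 ht
    simp only [k, this, h, if_false, if_true]
  have hadj : ∀ u v, (u ∈ B₁ ↔ v ∈ B₁) → u ≠ v → H.Adj u v := by
    intro u v h huv
    by_cases hu : u ∈ B₁
    · exact hclique1 (Finset.mem_coe.2 hu) (Finset.mem_coe.2 (h.1 hu)) huv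
    · exact hclique2 (Finset.mem_coe.2 ((hp2 u).1 hu))
        (Finset.mem_coe.2 ((hp2 v).1 (fun hv => hu (h.2 hv)))) huv
  clear_value r k N e
  have hker := exists_kernel H (fun v => v ∈ B₁) (fun v => v ∈ S₁ ∪ S₂) r hr hadj
    (by
      intro u v hu hv hne h
      have a1 := @hS1B u
      have a2 := @hS1B v
      have a3 := @hS2B u
      have a4 := @hS2B v
      have a5 := hp2 u
      have a6 := hp2 v
      have a7 := hSS u
      have a8 := hSS v
      have h' := h.symm
      simp only [Finset.mem_union] at hu hv
      rcases hu with hu | hu <;> rcases hv with hv | hv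
      · exact hne (iff_of_true (a1 hu) (a2 hv))
      · exact a7 hu v hv h
      · exact a8 hv u hu h'
      · exact hne (iff_of_false (a5.2 (a3 hu)) (a6.2 (a4 hv))))
    (by
      intro u v hu hv
      apply hrk
      have := hkS u hu
      have := hkS' v hv
      omega)
  obtain ⟨φ, h1, h2⟩ := kernel_list_coloring H
    (fun v u => H.Adj v u ∧ ((v ∈ B₁ ↔ u ∈ B₁) → r u < r v) ∧
      (¬ (v ∈ B₁ ↔ u ∈ B₁) → ¬ v ∈ S₁ ∪ S₂)) hker _ Finset.univ L rfl (by
      intro v _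
      have hrT : v ∈ T₁ ∪ T₂ → ∀ u, u ∉ T₁ ∪ T₂ → r v < r u := by
        intro hv u hu
        apply hrk
        have := hkT v hv
        have := hkT' u hu
        omega
      have hrS : v ∉ S₁ ∪ S₂ → ∀ u, u ∈ S₁ ∪ S₂ → r v < r u := by
        intro hv u hu
        apply hrk
        have := hkS u hu
        have := hkS' v hv
        omega
      rcases hcov v with hv | hv
      · refine outdeg_bound H B₁ B₂ T₁ S₁ _ r
          (fun v u => H.Adj v u ∧ ((v ∈ B₁ ↔ u ∈ B₁) → r u < r v) ∧
      (¬ (v ∈ B₁ ↔ u ∈ B₁) → ¬ v ∈ S₁ ∪ S₂)) v hS1B hS1c hv hB1 hT1c hcov (hdeg1 v hv)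
          ?_ ?_ ?_ ?_ (hLT1 v) (hL1 v) hST1
        · intro u hu h
          exact h.2.1 (iff_of_true hv hu)
        · intro u hu h
          refine ⟨h.1, fun hvS => h.2.2 ?_ (Finset.mem_union_left _ hvS)⟩
          exact fun hi => (hp2 u).2 hu (hi.1 hv)
        · intro hvT u hu huT
          refine hrT (Finset.mem_union_left _ hvT) u ?_
          rw [Finset.mem_union]
          exact fun h => h.elim huT (fun h => hd u hu (hT2 h))
        · intro hvS u hu
          refine hrS ?_ u (Finset.mem_union_left _ hu)
          rw [Finset.mem_union]
          exact fun h => h.elim hvS (fun h => hd v hv (hS2B h))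
      · refine outdeg_bound H B₂ B₁ T₂ S₂ _ r
          (fun v u => H.Adj v u ∧ ((v ∈ B₁ ↔ u ∈ B₁) → r u < r v) ∧
      (¬ (v ∈ B₁ ↔ u ∈ B₁) → ¬ v ∈ S₁ ∪ S₂)) v hS2B hS2c hv hB2 hT2c
          (fun u => (hcov u).symm) (hdeg2 v hv)
          ?_ ?_ ?_ ?_ (hLT2 v) (hL2 v) hST2
        · intro u hu h
          exact h.2.1 (iff_of_false ((hp2 v).2 hv) ((hp2 u).2 hu))
        · intro u hu h
          refine ⟨h.1, fun hvS => h.2.2 ?_ (Finset.mem_union_right _ hvS)⟩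
          exact fun hi => (hp2 v).2 hv (hi.2 hu)
        · intro hvT u hu huT
          refine hrT (Finset.mem_union_right _ hvT) u ?_
          rw [Finset.mem_union]
          exact fun h => h.elim (fun h => (hp2 u).2 hu (hT1 h)) huT
        · intro hvS u hu
          refine hrS ?_ u (Finset.mem_union_right _ hu)
          rw [Finset.mem_union]
          exact fun h => h.elim (fun h => (hp2 v).2 hv (hS1B h)) hvS)
  exact ⟨φ, fun v => h1 v (Finset.mem_univ v),
    fun u v h => h2 u (Finset.mem_univ u) v (Finset.mem_univ v) h⟩
end

section
/- Let H be a finite simple graph whose vertex set is covered by two disjoint cliques B₁ and B₂, each of size n with n ≥ 5863. Suppose there exist T₁ ⊆ B₁, T₂ ⊆ B₂, and f : V(H) → ℕ satisfying: (1) f(v) ≥ n for every v ∈ (B₁ \ T₁) ∪ (B₂ \ T₂); (2) f(v) ≥ n − 44 for every v ∈ T₁ ∪ T₂; (3) |T₁| ≤ 4400 and |T₂| ≤ 4400; and (4) Δ(H) − n + 1 ≤ 11. Then every f-correspondence assignment C for H admits a C-coloring. -/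
open Finset

/-- An `f`-correspondence assignment for `H`: for each edge `vw` a partial matching between
`{v} × {1,…,f v}` and `{w} × {1,…,f w}`. -/
structure CorrAssignment {V : Type*} (H : SimpleGraph V) (f : V → ℕ) where
  /-- `M u v i j` means color `i` at `u` is matched with color `j` at `v`. -/
  M : V → V → ℕ → ℕ → Prop
  symm : ∀ u v i j, M u v i j → M v u j i
  adj : ∀ u v i j, M u v i j → H.Adj u v
  bounds : ∀ u v i j, M u v i j → 1 ≤ i ∧ i ≤ f u ∧ 1 ≤ j ∧ j ≤ f v
  matching_right : ∀ u v i j j', M u v i j → M u v i j' → j = j'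
  matching_left : ∀ u v i i' j, M u v i j → M u v i' j → i = i'

/-- A `C`-coloring: each vertex `v` gets a color in `{1,…,f v}` so that across every edge
the chosen colors are unmatched. -/
def CorrColorable {V : Type*} (H : SimpleGraph V) (f : V → ℕ)
    (C : CorrAssignment H f) : Prop :=
  ∃ φ : V → ℕ, (∀ v, 1 ≤ φ v ∧ φ v ≤ f v) ∧ ∀ u v, H.Adj u v → ¬ C.M u v (φ u) (φ v)

section Helpers

open Classical in
/-- Colors of `L v` killed by the partial coloring `φ` on `S`. -/
noncomputable def killedSet {V : Type} {H : SimpleGraph V} {f : V → ℕ} (C : CorrAssignment H f)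
    (L : V → Finset ℕ) (S : Finset V) (φ : V → ℕ) (v : V) : Finset ℕ :=
  (L v).filter (fun c => ∃ y ∈ S, C.M y v (φ y) c)

/-- `φ` is a proper partial coloring on `S` from the lists `L`. -/
def ProperOn {V : Type} {H : SimpleGraph V} {f : V → ℕ} (C : CorrAssignment H f)
    (L : V → Finset ℕ) (S : Finset V) (φ : V → ℕ) : Prop :=
  (∀ x ∈ S, φ x ∈ L x) ∧ ∀ x ∈ S, ∀ y ∈ S, ¬ C.M x y (φ x) (φ y)

/-- Number of neighbours of `v` in `S`. -/
def dg {V : Type} (H : SimpleGraph V) [DecidableRel H.Adj] (S : Finset V) (v : V) : ℕ :=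
  (S.filter (fun y => H.Adj v y)).card

variable {V : Type} [DecidableEq V] {H : SimpleGraph V} [DecidableRel H.Adj] {f : V → ℕ}
  (C : CorrAssignment H f) (L : V → Finset ℕ)

theorem dg_mono {S S' : Finset V} (h : S ⊆ S') (v : V) : dg H S v ≤ dg H S' v :=
  card_le_card (filter_subset_filter _ h)

theorem dg_le_card (S : Finset V) (v : V) : dg H S v ≤ S.card := card_filter_le _ _

theorem dg_union_le (S S' : Finset V) (v : V) : dg H (S ∪ S') v ≤ dg H S v + dg H S' v := by
  unfold dg
  rw [filter_union]
  exact card_union_le _ _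

theorem dg_sdiff {S S' : Finset V} (h : S ⊆ S') (v : V) :
    dg H S' v = dg H S v + dg H (S' \ S) v := by
  unfold dg
  rw [← card_union_of_disjoint, ← filter_union, union_sdiff_of_subset h]
  exact disjoint_filter_filter disjoint_sdiff

theorem dg_lt_card {S : Finset V} {v : V} (h : v ∈ S) : dg H S v + 1 ≤ S.card := by
  have : S.filter (fun y => H.Adj v y) ⊆ S.erase v := by
    intro y hy
    rw [mem_filter] at hy
    exact mem_erase.2 ⟨fun e => H.loopless.irrefl v (e ▸ hy.2), hy.1⟩
  have h2 := card_le_card this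
  rw [card_erase_of_mem h] at h2
  have := card_pos.2 ⟨v, h⟩
  unfold dg
  omega

theorem killed_le (S : Finset V) (φ : V → ℕ) (v : V) :
    (killedSet C L S φ v).card ≤ dg H S v := by
  classical
  have : killedSet C L S φ v ⊆ (S.filter (fun y => H.Adj v y)).biUnion
      (fun y => (L v).filter (fun c => C.M y v (φ y) c)) := by
    intro c hc
    simp only [killedSet, mem_filter] at hc
    obtain ⟨h1, y, hy, hM⟩ := hc
    simp only [mem_biUnion, mem_filter]
    exact ⟨y, ⟨hy, (C.adj _ _ _ _ hM).symm⟩, h1, hM⟩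
  refine (card_le_card this).trans ((card_biUnion_le_card_mul _ _ 1 ?_).trans (by simp [dg]))
  intro y _
  rw [card_le_one]
  intro a ha b hb
  exact C.matching_right _ _ _ _ _ (mem_filter.1 ha).2 (mem_filter.1 hb).2

theorem killed_union (S S' : Finset V) (φ φ' : V → ℕ) (h : S ⊆ S')
    (he : ∀ y ∈ S, φ' y = φ y) (v : V) :
    killedSet C L S' φ' v ⊆ killedSet C L S φ v ∪ killedSet C L (S' \ S) φ' v := by
  intro c hc
  simp only [killedSet, mem_filter, mem_union, mem_sdiff] at hc ⊢
  obtain ⟨h1, y, hy, hM⟩ := hc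
  by_cases hS : y ∈ S
  · left
    exact ⟨h1, y, hS, by rwa [← he y hS]⟩
  · right
    exact ⟨h1, y, ⟨hy, hS⟩, hM⟩

/-- Savings are monotone. -/
theorem saving_mono {S S' : Finset V} {φ φ' : V → ℕ} (h : S ⊆ S')
    (he : ∀ y ∈ S, φ' y = φ y) {v : V} {s : ℕ}
    (hs : (killedSet C L S φ v).card + s ≤ dg H S v) :
    (killedSet C L S' φ' v).card + s ≤ dg H S' v := by
  have h1 := card_le_card (killed_union C L S S' φ φ' h he v)
  have h2 := card_union_le (killedSet C L S φ v) (killedSet C L (S' \ S) φ' v)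
  have h3 := killed_le C L (S' \ S) φ' v
  have h4 := dg_sdiff (H := H) h v
  omega

theorem extend_one {S : Finset V} {φ : V → ℕ} (hP : ProperOn C L S φ) {x : V} (hx : x ∉ S)
    {a : ℕ} (ha : a ∈ L x) (hk : a ∉ killedSet C L S φ x) :
    ProperOn C L (insert x S) (Function.update φ x a) := by
  have hne : ∀ y ∈ S, y ≠ x := fun y hy e => hx (e ▸ hy)
  have hk' : ∀ y ∈ S, ¬ C.M y x (φ y) a := by
    intro y hy hM
    exact hk (by simp only [killedSet, mem_filter]; exact ⟨ha, y, hy, hM⟩)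
  refine ⟨?_, ?_⟩
  · intro y hy
    rcases mem_insert.1 hy with rfl | hy
    · simpa using ha
    · rw [Function.update_of_ne (hne y hy)]; exact hP.1 y hy
  · intro y hy z hz hM
    rcases mem_insert.1 hy with rfl | hy'
    · rcases mem_insert.1 hz with rfl | hz
      · exact H.loopless.irrefl _ (C.adj _ _ _ _ hM)
      · rw [Function.update_self, Function.update_of_ne (hne z hz)] at hM
        exact hk' z hz (C.symm _ _ _ _ hM)
    · rcases mem_insert.1 hz with rfl | hz
      · rw [Function.update_self, Function.update_of_ne (hne y hy')] at hM
        exact hk' y hy' hM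
      · rw [Function.update_of_ne (hne y hy'), Function.update_of_ne (hne z hz)] at hM
        exact hP.2 y hy' z hz hM

theorem greedy (s : V → ℕ) (X : Finset V) : ∀ (S : Finset V) (φ : V → ℕ), ProperOn C L S φ →
    Disjoint X S → (∀ x ∈ X, (killedSet C L S φ x).card + s x ≤ dg H S x) →
    (∀ x ∈ X, dg H (S ∪ X) x < (L x).card + s x) →
    ∃ φ', ProperOn C L (S ∪ X) φ' ∧ ∀ y ∈ S, φ' y = φ y := by
  induction X using Finset.induction_on with
  | empty => intro S φ hP _ _ _; exact ⟨φ, by simpa using hP, fun _ _ => rfl⟩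
  | insert x X hxX ih =>
    intro S φ hP hd hs hc
    have hxS : x ∉ S := disjoint_left.1 hd (mem_insert_self _ _)
    have h1 := hs x (mem_insert_self _ _)
    have h2 := hc x (mem_insert_self _ _)
    have h3 := dg_mono (H := H) (subset_union_left : S ⊆ S ∪ insert x X) x
    obtain ⟨a, ha, hak⟩ : ∃ a ∈ L x, a ∉ killedSet C L S φ x := by
      apply exists_mem_notMem_of_card_lt_card
      omega
    have he : ∀ y ∈ S, Function.update φ x a y = φ y := fun y hy =>
      Function.update_of_ne (ne_of_mem_of_not_mem hy hxS) _ _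
    have hU : insert x S ∪ X = S ∪ insert x X := by
      ext; simp only [mem_union, mem_insert]; tauto
    obtain ⟨φ', hP', he'⟩ := ih (insert x S) _ (extend_one C L hP hxS ha hak)
      (by
        rw [disjoint_insert_right]
        exact ⟨hxX, disjoint_of_subset_left (subset_insert _ _) hd⟩)
      (fun y hy => saving_mono C L (subset_insert _ _) he (hs y (mem_insert_of_mem hy)))
      (fun y hy => by rw [hU]; exact hc y (mem_insert_of_mem hy))
    rw [hU] at hP'
    exact ⟨φ', hP', fun y hy => (he' y (mem_insert_of_mem hy)).trans (he y hy)⟩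

theorem greedy0 (X S : Finset V) (φ : V → ℕ) (hP : ProperOn C L S φ)
    (hd : Disjoint X S) (hc : ∀ x ∈ X, dg H (S ∪ X) x < (L x).card) :
    ∃ φ', ProperOn C L (S ∪ X) φ' ∧ ∀ y ∈ S, φ' y = φ y :=
  greedy C L (fun _ => 0) X S φ hP hd (fun x _ => by simpa using killed_le C L S φ x)
    (by simpa using hc)

/-- Choosing colors at `w` and `u` killing at most one common color at `v`. -/
theorem choose_pair {w u v : V} {A B : Finset ℕ}
    (hAB : (L v).card < A.card + B.card) (hA : A.Nonempty) (hB : B.Nonempty) :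
    ∃ a ∈ A, ∃ b ∈ B, ∃ c₀, ∀ c ∈ L v, C.M w v a c ∨ C.M u v b c → c = c₀ := by
  classical
  by_cases h1 : ∃ a ∈ A, ∀ c ∈ L v, ¬ C.M w v a c
  · obtain ⟨a, ha, h⟩ := h1
    obtain ⟨b, hb⟩ := hB
    refine ⟨a, ha, b, hb, ?_⟩
    by_cases h2 : ∃ c, C.M u v b c
    · obtain ⟨c, hc⟩ := h2
      refine ⟨c, fun c' hc' hM => ?_⟩
      rcases hM with hM | hM
      · exact (h _ hc' hM).elim
      · exact C.matching_right _ _ _ _ _ hM hc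
    · exact ⟨0, fun c' hc' hM => by
        rcases hM with hM | hM
        · exact (h _ hc' hM).elim
        · exact (h2 ⟨_, hM⟩).elim⟩
  by_cases h2 : ∃ b ∈ B, ∀ c ∈ L v, ¬ C.M u v b c
  · obtain ⟨b, hb, h⟩ := h2
    obtain ⟨a, ha⟩ := hA
    refine ⟨a, ha, b, hb, ?_⟩
    by_cases h2 : ∃ c, C.M w v a c
    · obtain ⟨c, hc⟩ := h2
      refine ⟨c, fun c' hc' hM => ?_⟩
      rcases hM with hM | hM
      · exact C.matching_right _ _ _ _ _ hM hc
      · exact (h _ hc' hM).elim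
    · exact ⟨0, fun c' hc' hM => by
        rcases hM with hM | hM
        · exact (h2 ⟨_, hM⟩).elim
        · exact (h _ hc' hM).elim⟩
  push Not at h1 h2
  choose! g hg hgM using h1
  choose! k hk hkM using h2
  have cg : (A.image g).card = A.card := card_image_of_injOn (fun a ha a' ha' e =>
    C.matching_left _ _ _ _ _ (hgM a ha) (e ▸ hgM a' ha'))
  have ck : (B.image k).card = B.card := card_image_of_injOn (fun a ha a' ha' e =>
    C.matching_left _ _ _ _ _ (hkM a ha) (e ▸ hkM a' ha'))
  have hnd : ¬ Disjoint (A.image g) (B.image k) := by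
    intro hd
    have h3 := card_union_of_disjoint hd
    have h4 : A.image g ∪ B.image k ⊆ L v := by
      apply union_subset
      · intro c hc; obtain ⟨a, ha, rfl⟩ := mem_image.1 hc; exact hg a ha
      · intro c hc; obtain ⟨a, ha, rfl⟩ := mem_image.1 hc; exact hk a ha
    have := card_le_card h4
    omega
  obtain ⟨c, hc1, hc2⟩ := not_disjoint_iff.1 hnd
  obtain ⟨a, ha, rfl⟩ := mem_image.1 hc1
  obtain ⟨b, hb, hab⟩ := mem_image.1 hc2
  refine ⟨a, ha, b, hb, g a, fun c _ hM => ?_⟩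
  rcases hM with hM | hM
  · exact C.matching_right _ _ _ _ _ hM (hgM a ha)
  · rw [← hab]; exact C.matching_right _ _ _ _ _ hM (hkM b hb)

/-- The pair step: colour nonadjacent `w, u`, both neighbours of `v`, gaining one saving at `v`. -/
theorem pair_step {S : Finset V} {φ : V → ℕ} (hP : ProperOn C L S φ) {w u v : V}
    (hw : w ∉ S) (hu : u ∉ S) (hwu : w ≠ u) (hnadj : ¬ H.Adj w u)
    (hvw : H.Adj v w) (hvu : H.Adj v u)
    (h1 : (L v).card + 2 * S.card < (L w).card + (L u).card)
    (h2 : S.card < (L w).card) (h3 : S.card < (L u).card) :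
    ∃ φ', ProperOn C L (insert u (insert w S)) φ' ∧ (∀ y ∈ S, φ' y = φ y) ∧
      ∀ s, (killedSet C L S φ v).card + s ≤ dg H S v →
        (killedSet C L (insert u (insert w S)) φ' v).card + (s + 1)
          ≤ dg H (insert u (insert w S)) v := by
  have kw := (killed_le C L S φ w).trans (dg_le_card S w)
  have ku := (killed_le C L S φ u).trans (dg_le_card S u)
  have aw := le_card_sdiff (killedSet C L S φ w) (L w)
  have au := le_card_sdiff (killedSet C L S φ u) (L u)
  obtain ⟨a, ha, b, hb, c₀, hc⟩ := choose_pair C L (w := w) (u := u) (v := v)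
    (A := L w \ killedSet C L S φ w) (B := L u \ killedSet C L S φ u)
    (by omega) (card_pos.1 (by omega)) (card_pos.1 (by omega))
  rw [mem_sdiff] at ha hb
  have P1 := extend_one C L hP hw ha.1 ha.2
  have hu' : u ∉ insert w S := by simp [hu, hwu.symm]
  have hbk : b ∉ killedSet C L (insert w S) (Function.update φ w a) u := by
    intro h
    simp only [killedSet, mem_filter] at h
    obtain ⟨h, y, hy, hM⟩ := h
    rcases mem_insert.1 hy with rfl | hy
    · exact hnadj (C.adj _ _ _ _ hM)
    · rw [Function.update_of_ne (ne_of_mem_of_not_mem hy hw)] at hM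
      apply hb.2
      simp only [killedSet, mem_filter]
      exact ⟨h, y, hy, hM⟩
  have P2 := extend_one C L P1 hu' hb.1 hbk
  have he : ∀ y ∈ S, Function.update (Function.update φ w a) u b y = φ y := by
    intro y hy
    rw [Function.update_of_ne (ne_of_mem_of_not_mem hy hu), Function.update_of_ne (ne_of_mem_of_not_mem hy hw)]
  refine ⟨_, P2, he, ?_⟩
  intro s hs
  have hsub : S ⊆ insert u (insert w S) := (subset_insert _ _).trans (subset_insert _ _)
  have g1 := card_le_card (killed_union C L S _ φ _ hsub he v)
  have g2 := card_union_le (killedSet C L S φ v)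
    (killedSet C L (insert u (insert w S) \ S) (Function.update (Function.update φ w a) u b) v)
  have g3 : (killedSet C L (insert u (insert w S) \ S)
      (Function.update (Function.update φ w a) u b) v).card ≤ 1 := by
    rw [card_le_one_iff_subset_singleton]
    refine ⟨c₀, fun c hcm => ?_⟩
    simp only [killedSet, mem_filter, mem_sdiff, mem_insert] at hcm
    obtain ⟨hcL, y, ⟨hy, hyS⟩, hM⟩ := hcm
    rw [mem_singleton]
    apply hc c hcL
    rcases hy with rfl | rfl | hy
    · right; simpa using hM
    · left; rw [Function.update_of_ne hwu] at hM; simpa using hM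
    · exact (hyS hy).elim
  have g4 := dg_sdiff (H := H) hsub v
  have g5 : 2 ≤ dg H (insert u (insert w S) \ S) v := by
    rw [← card_pair hwu]
    apply card_le_card
    intro y hy
    simp only [mem_insert, mem_singleton] at hy
    simp only [mem_filter, mem_sdiff, mem_insert]
    rcases hy with rfl | rfl
    · exact ⟨⟨by simp, hw⟩, hvw⟩
    · exact ⟨⟨by simp, hu⟩, hvu⟩
  omega

/-- Choose `k ≤ 11` vertices with no common neighbours in `B₂`. -/
theorem choose_vs {n : ℕ} (hn : 5863 ≤ n) (B₁ B₂ T₁ : Finset V) (hcard1 : B₁.card = n)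
    (hT1c : T₁.card ≤ 4400) (hd1 : ∀ v ∈ B₁, dg H B₂ v ≤ 11) (hd2 : ∀ v ∈ B₂, dg H B₁ v ≤ 11) :
    ∀ k ≤ 11, ∃ X ⊆ B₁ \ T₁, X.card = k ∧
      ∀ v ∈ X, ∀ v' ∈ X, ∀ w ∈ B₂, H.Adj v w → H.Adj v' w → v = v' := by
  intro k
  induction k with
  | zero => intro _; exact ⟨∅, by simp, by simp, by simp⟩
  | succ k ih =>
    intro hk
    obtain ⟨X, hX, hXc, hXd⟩ := ih (by omega)
    let Wn := X.biUnion (fun v => B₂.filter (fun w => H.Adj v w))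
    have hXB : X ⊆ B₁ := hX.trans sdiff_subset
    have hW : Wn.card ≤ X.card * 11 :=
      card_biUnion_le_card_mul _ _ _ (fun v hv => hd1 v (hXB hv))
    let F := Wn.biUnion (fun w => B₁.filter (fun v => H.Adj w v))
    have hF : F.card ≤ Wn.card * 11 := card_biUnion_le_card_mul _ _ _ (fun w hw => by
      obtain ⟨v, _, hw⟩ := mem_biUnion.1 hw
      exact hd2 w (mem_filter.1 hw).1)
    obtain ⟨x, hx, hxn⟩ : ∃ x ∈ B₁, x ∉ T₁ ∪ (X ∪ F) := by
      apply exists_mem_notMem_of_card_lt_card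
      have := card_union_le T₁ (X ∪ F)
      have := card_union_le X F
      omega
    simp only [mem_union, not_or] at hxn
    obtain ⟨hxT, hxX, hxF⟩ := hxn
    have key : ∀ v ∈ X, ∀ w ∈ B₂, H.Adj v w → ¬ H.Adj x w := by
      intro v hv w hw h1 h2
      apply hxF
      exact mem_biUnion.2 ⟨w, mem_biUnion.2 ⟨v, hv, mem_filter.2 ⟨hw, h1⟩⟩,
        mem_filter.2 ⟨hx, h2.symm⟩⟩
    refine ⟨insert x X, ?_, by rw [card_insert_of_notMem hxX, hXc], ?_⟩
    · exact insert_subset (mem_sdiff.2 ⟨hx, hxT⟩) hX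
    · intro v hv v' hv' w hw h1 h2
      rcases mem_insert.1 hv with rfl | hv1
      · rcases mem_insert.1 hv' with rfl | hv'
        · rfl
        · exact (key _ hv' w hw h2 h1).elim
      · rcases mem_insert.1 hv' with rfl | hv'
        · exact (key _ hv1 w hw h1 h2).elim
        · exact hXd v hv1 v' hv' w hw h1 h2

/-- The pair stage. -/
theorem pair_stage {n : ℕ} (hn : 5863 ≤ n) (B₁ B₂ X : Finset V) (hcard1 : B₁.card = n)
    (hdisj : Disjoint B₁ B₂) (hclique1 : H.IsClique ↑B₁)
    (hd2 : ∀ v ∈ B₂, dg H B₁ v ≤ 11)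
    (hX : X ⊆ B₁) (hXc : X.card ≤ 11)
    (hXd : ∀ v ∈ X, ∀ v' ∈ X, ∀ w ∈ B₂, H.Adj v w → H.Adj v' w → v = v')
    (hLX : ∀ v ∈ X, (L v).card = n) (hL : ∀ v, n - 44 ≤ (L v).card)
    (W : Finset V) : W ⊆ B₂ → W.card ≤ 121 → (∀ w ∈ W, ∃ v ∈ X, H.Adj v w) →
    ∃ U φ, U ⊆ B₁ \ X ∧ U.card ≤ W.card ∧ ProperOn C L (U ∪ W) φ ∧
      ∀ v ∈ X, (killedSet C L (U ∪ W) φ v).card + dg H W v ≤ dg H (U ∪ W) v := by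
  induction W using Finset.induction_on with
  | empty =>
    intro _ _ _
    refine ⟨∅, fun _ => 0, by simp, by simp, ⟨by simp, by simp⟩, fun v _ => ?_⟩
    have := killed_le C L (∅ ∪ ∅) (fun _ => 0) v
    simp [dg] at this ⊢
    exact this
  | insert w W hwW ih =>
    intro hWB hWc hWv
    rw [card_insert_of_notMem hwW] at hWc
    obtain ⟨U, φ, hU, hUc, hP, hs⟩ := ih ((subset_insert _ _).trans hWB) (by omega)
      (fun w hw => hWv w (mem_insert_of_mem hw))
    obtain ⟨v, hv, hvw⟩ := hWv w (mem_insert_self _ _)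
    have hwB : w ∈ B₂ := hWB (mem_insert_self _ _)
    obtain ⟨u, hu, hun⟩ : ∃ u ∈ B₁, u ∉ X ∪ (U ∪ B₁.filter (fun y => H.Adj w y)) := by
      apply exists_mem_notMem_of_card_lt_card
      have := card_union_le X (U ∪ B₁.filter (fun y => H.Adj w y))
      have := card_union_le U (B₁.filter (fun y => H.Adj w y))
      have h := hd2 w hwB
      unfold dg at h
      omega
    simp only [mem_union, not_or, mem_filter, not_and] at hun
    obtain ⟨huX, huU, huw⟩ := hun
    have dB : ∀ x ∈ B₁, x ∉ B₂ := fun _ hx => disjoint_left.1 hdisj hx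
    have hUB : U ⊆ B₁ := hU.trans sdiff_subset
    have hWB' : W ⊆ B₂ := (subset_insert _ _).trans hWB
    have cS := card_union_le U W
    have l1 := hLX v hv
    have l2 := hL w
    have l3 := hL u
    obtain ⟨φ', hP', he, hsv⟩ := pair_step C L hP (w := w) (u := u) (v := v)
      (by
        rw [mem_union, not_or]
        exact ⟨fun h => dB w (hUB h) hwB, hwW⟩)
      (by
        rw [mem_union, not_or]
        exact ⟨huU, fun h => dB u hu (hWB' h)⟩)
      (fun e => dB u hu (e ▸ hwB)) (huw hu) hvw
      (hclique1 (hX hv) hu (fun e => huX (e ▸ hv))) (by omega) (by omega) (by omega)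
    have hE : insert u (insert w (U ∪ W)) = insert u U ∪ insert w W := by
      ext; simp only [mem_union, mem_insert]; tauto
    have hsub : U ∪ W ⊆ insert u U ∪ insert w W :=
      union_subset_union (subset_insert _ _) (subset_insert _ _)
    rw [hE] at hP' hsv
    refine ⟨insert u U, φ', ?_, ?_, hP', ?_⟩
    · exact insert_subset (mem_sdiff.2 ⟨hu, huX⟩) hU
    · rw [card_insert_of_notMem huU, card_insert_of_notMem hwW]; omega
    · intro v' hv'
      by_cases hvv : v' = v
      · subst hvv
        have := hsv _ (hs v' hv')
        have h2 : dg H (insert w W) v' ≤ dg H W v' + 1 := by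
          unfold dg
          rw [filter_insert]
          rw [if_pos hvw]; exact card_insert_le _ _
        omega
      · have h2 : dg H (insert w W) v' = dg H W v' := by
          unfold dg
          rw [filter_insert, if_neg]
          exact fun h => hvv (hXd v' hv' v hv w hwB h hvw)
        rw [h2]
        exact saving_mono C L hsub he (hs v' hv')

end Helpers

set_option maxHeartbeats 2000000 in
/-- Two-cliques correspondence-coloring lemma: let `H` be covered by two disjoint cliques
`B₁, B₂`, each of size `n ≥ 5863`, with `T₁ ⊆ B₁`, `T₂ ⊆ B₂` of size at most 4400, and let
`f` satisfy `f(v) ≥ n` off `T₁ ∪ T₂` and `f(v) ≥ n − 44` on `T₁ ∪ T₂`.  If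
`Δ(H) − n + 1 ≤ 11`, then every `f`-correspondence assignment `C` for `H` admits a
`C`-coloring. -/
theorem two_cliques_corr_coloring {V : Type} [Fintype V] [DecidableEq V]
    (H : SimpleGraph V) [DecidableRel H.Adj] (n : ℕ) (hn : 5863 ≤ n)
    (B₁ B₂ T₁ T₂ : Finset V) (f : V → ℕ)
    (hdisj : Disjoint B₁ B₂) (hcover : ∀ v : V, v ∈ B₁ ∪ B₂)
    (hclique1 : H.IsClique ↑B₁) (hclique2 : H.IsClique ↑B₂)
    (hcard1 : B₁.card = n) (hcard2 : B₂.card = n)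
    (hT1 : T₁ ⊆ B₁) (hT2 : T₂ ⊆ B₂)
    (hf1 : ∀ v ∈ (B₁ \ T₁) ∪ (B₂ \ T₂), n ≤ f v)
    (hf2 : ∀ v ∈ T₁ ∪ T₂, n - 44 ≤ f v)
    (hT1c : T₁.card ≤ 4400) (hT2c : T₂.card ≤ 4400)
    (hΔ : H.maxDegree - n + 1 ≤ 11)
    (C : CorrAssignment H f) :
    CorrColorable H f C := by
  classical
  have cross : ∀ B B' : Finset V, Disjoint B B' → H.IsClique (B : Set V) → B.card = n →
      ∀ v ∈ B, dg H B' v ≤ 11 := by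
    intro B B' hd hc hcd v hv
    have h1 : H.degree v ≤ H.maxDegree := H.degree_le_maxDegree v
    have h2 : (B.erase v) ∪ B'.filter (fun y => H.Adj v y) ⊆ H.neighborFinset v := by
      intro y hy
      rw [SimpleGraph.mem_neighborFinset]
      rcases mem_union.1 hy with hy | hy
      · exact hc hv (mem_of_mem_erase hy) (ne_of_mem_erase hy).symm
      · exact (mem_filter.1 hy).2
    have h3 := card_le_card h2
    rw [card_union_of_disjoint, card_erase_of_mem hv, SimpleGraph.card_neighborFinset_eq_degree]
      at h3
    · unfold dg; omega
    · exact disjoint_of_subset_left (erase_subset _ _)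
        (disjoint_of_subset_right (filter_subset _ _) hd)
  have hd1 := cross B₁ B₂ hdisj hclique1 hcard1
  have hd2 := cross B₂ B₁ hdisj.symm hclique2 hcard2
  have dB : ∀ x ∈ B₁, x ∉ B₂ := fun _ hx => disjoint_left.1 hdisj hx
  obtain ⟨L, hLf, hLn, hL⟩ : ∃ L : V → Finset ℕ, (∀ v, L v ⊆ Icc 1 (f v)) ∧
      (∀ v ∉ T₁ ∪ T₂, (L v).card = n) ∧ (∀ v, n - 44 ≤ (L v).card) := by
    refine ⟨fun v => Icc 1 (min n (f v)), fun v => Icc_subset_Icc_right (min_le_right _ _), ?_, ?_⟩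
    · intro v hv
      have : n ≤ f v := by
        apply hf1
        have := hcover v
        simp only [mem_union, mem_sdiff, not_or] at *
        tauto
      simp [this]
    · intro v
      have : n - 44 ≤ f v := by
        by_cases hv : v ∈ T₁ ∪ T₂
        · exact hf2 v hv
        · have : n ≤ f v := by
            apply hf1
            have := hcover v
            simp only [mem_union, mem_sdiff, not_or] at *
            tauto
          omega
      simp [this]
  have hLn1 : ∀ v ∈ B₁, v ∉ T₁ → (L v).card = n := fun v hv hvT =>
    hLn v (by rw [mem_union, not_or]; exact ⟨hvT, fun h => dB v hv (hT2 h)⟩)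
  have hLn2 : ∀ v ∈ B₂, v ∉ T₂ → (L v).card = n := fun v hv hvT =>
    hLn v (by rw [mem_union, not_or]; exact ⟨fun h => dB v (hT1 h) hv, hvT⟩)
  obtain ⟨X, hX, hXc, hXd⟩ := choose_vs hn B₁ B₂ T₁ hcard1 hT1c hd1 hd2 11 le_rfl
  have hXB : X ⊆ B₁ := hX.trans sdiff_subset
  have hXT : ∀ v ∈ X, v ∉ T₁ := fun v hv => (mem_sdiff.1 (hX hv)).2
  obtain ⟨W, hWdef⟩ : ∃ W, W = X.biUnion (fun v => B₂.filter (fun w => H.Adj v w)) := ⟨_, rfl⟩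
  have hWc : W.card ≤ 121 := by
    have : W.card ≤ X.card * 11 := by
      rw [hWdef]
      exact card_biUnion_le_card_mul _ _ _ (fun v hv => hd1 v (hXB hv))
    omega
  have hWm : ∀ w, w ∈ W ↔ ∃ v ∈ X, w ∈ B₂ ∧ H.Adj v w := by
    intro w; rw [hWdef]; simp
  have hWB : W ⊆ B₂ := fun w hw => by
    obtain ⟨v, _, h, _⟩ := (hWm w).1 hw; exact h
  obtain ⟨U, φ₀, hU, hUc, hP0, hs0⟩ := pair_stage C L hn B₁ B₂ X hcard1 hdisj hclique1 hd2 hXB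
    hXc.le hXd (fun v hv => hLn1 v (hXB hv) (hXT v hv)) hL W hWB hWc (fun w hw => by
      obtain ⟨v, hv, _, h⟩ := (hWm w).1 hw; exact ⟨v, hv, h⟩)
  have hUB : U ⊆ B₁ := hU.trans sdiff_subset
  have hsX : ∀ v ∈ X, (killedSet C L (U ∪ W) φ₀ v).card + dg H B₂ v ≤ dg H (U ∪ W) v := by
    intro v hv
    have : dg H B₂ v ≤ dg H W v := card_le_card (fun w hw => by
      rw [mem_filter] at hw ⊢
      exact ⟨(hWm w).2 ⟨v, hv, hw⟩, hw.2⟩)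
    have := hs0 v hv
    omega
  -- choose the final vertices of `B₂`
  obtain ⟨Z, hZ, hZc⟩ : ∃ Z ⊆ B₂ \ (T₂ ∪ (W ∪ U.biUnion (fun u => B₂.filter (fun w => H.Adj u w)))),
      Z.card = 11 := by
    apply exists_subset_card_eq
    have h1 := le_card_sdiff (T₂ ∪ (W ∪ U.biUnion (fun u => B₂.filter (fun w => H.Adj u w)))) B₂
    have h2 := card_union_le T₂ (W ∪ U.biUnion (fun u => B₂.filter (fun w => H.Adj u w)))
    have h3 := card_union_le W (U.biUnion (fun u => B₂.filter (fun w => H.Adj u w)))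
    have h4 : (U.biUnion (fun u => B₂.filter (fun w => H.Adj u w))).card ≤ U.card * 11 :=
      card_biUnion_le_card_mul _ _ _ (fun u hu => hd1 u (hUB hu))
    omega
  have hZB : Z ⊆ B₂ := hZ.trans sdiff_subset
  have hZp : ∀ z ∈ Z, z ∉ T₂ ∧ z ∉ W ∧ ∀ u ∈ U, ¬ H.Adj z u := by
    intro z hz
    have h := mem_sdiff.1 (hZ hz)
    simp only [mem_union, not_or, mem_biUnion, mem_filter, not_exists, not_and] at h
    exact ⟨h.2.1, h.2.2.1, fun u hu ha => h.2.2.2 u hu h.1 ha.symm⟩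
  -- step 1 : `T₂`
  obtain ⟨φ₁, hP1, he1⟩ := greedy0 C L (T₂ \ (U ∪ W)) _ φ₀ hP0 sdiff_disjoint (by
    intro x hx
    rw [mem_sdiff] at hx
    rw [union_sdiff_self_eq_union]
    have h1 := dg_le_card (H := H) (U ∪ W ∪ T₂) x
    have h2 := card_union_le (U ∪ W) T₂
    have h3 := card_union_le U W
    have := hL x
    omega)
  rw [union_sdiff_self_eq_union] at hP1
  -- step 2
  have hA2 : ∀ x ∈ (B₂ \ Z) \ (U ∪ W ∪ T₂), x ∈ B₂ ∧ x ∉ Z ∧ x ∉ T₂ := by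
    intro x hx
    simp only [mem_sdiff, mem_union, not_or] at hx
    exact ⟨hx.1.1, hx.1.2, hx.2.2⟩
  have hE2 : U ∪ W ∪ T₂ ∪ (B₂ \ Z) \ (U ∪ W ∪ T₂) = U ∪ (B₂ \ Z) := by
    rw [union_sdiff_self_eq_union]
    ext x
    simp only [mem_union, mem_sdiff]
    have a1 := @hWB x
    have a2 := @hT2 x
    have a3 := hZp x
    tauto
  obtain ⟨φ₂, hP2, he2⟩ := greedy0 C L ((B₂ \ Z) \ (U ∪ W ∪ T₂)) _ φ₁ hP1 sdiff_disjoint (by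
    intro x hx
    obtain ⟨hxB, hxZ, hxT⟩ := hA2 x hx
    rw [hE2, hLn2 x hxB hxT]
    have h1 := dg_union_le (H := H) U (B₂ \ Z) x
    have h2 := (dg_mono (H := H) hUB x).trans (hd2 x hxB)
    have h3 := dg_lt_card (H := H) (mem_sdiff.2 ⟨hxB, hxZ⟩)
    have h4 := card_sdiff_of_subset hZB
    omega)
  rw [hE2] at hP2
  -- step 3
  have hE3 : U ∪ (B₂ \ Z) ∪ Z = U ∪ B₂ := by
    rw [union_assoc, sdiff_union_of_subset hZB]
  obtain ⟨φ₃, hP3, he3⟩ := greedy0 C L Z _ φ₂ hP2 (by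
    rw [disjoint_union_right]
    refine ⟨disjoint_left.2 (fun z hz hu => dB z (hUB hu) (hZB hz)), disjoint_sdiff⟩) (by
    intro x hx
    rw [hE3, hLn2 x (hZB hx) (hZp x hx).1]
    have h1 := dg_union_le (H := H) U B₂ x
    have h2 : dg H U x = 0 := by
      unfold dg
      rw [card_eq_zero, filter_eq_empty_iff]
      exact fun u hu => (hZp x hx).2.2 u hu
    have h3 := dg_lt_card (H := H) (hZB hx)
    omega)
  rw [hE3] at hP3
  -- step 4 : `T₁`
  have hXU : ∀ v ∈ X, v ∉ U := fun v hv hu => (mem_sdiff.1 (hU hu)).2 hv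
  have hE4 : U ∪ B₂ ∪ T₁ \ U = U ∪ T₁ ∪ B₂ := by
    ext x; simp only [mem_union, mem_sdiff]; tauto
  obtain ⟨φ₄, hP4, he4⟩ := greedy0 C L (T₁ \ U) _ φ₃ hP3 (by
    rw [disjoint_union_right]
    refine ⟨sdiff_disjoint, disjoint_left.2 (fun z hz => dB z (hT1 (mem_sdiff.1 hz).1))⟩) (by
    intro x hx
    rw [mem_sdiff] at hx
    rw [hE4]
    have h1 := dg_union_le (H := H) (U ∪ T₁) B₂ x
    have h2 := hd1 x (hT1 hx.1)
    have h3 := dg_le_card (H := H) (U ∪ T₁) x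
    have h4 := card_union_le U T₁
    have := hL x
    omega)
  rw [hE4] at hP4
  -- step 5
  have hE5 : U ∪ T₁ ∪ B₂ ∪ (B₁ \ X) \ (U ∪ T₁) = (B₁ \ X) ∪ B₂ := by
    ext x
    simp only [mem_union, mem_sdiff]
    have a1 := @hUB x
    have a2 := @hT1 x
    have a3 := hXT x
    have a4 := hXU x
    tauto
  obtain ⟨φ₅, hP5, he5⟩ := greedy0 C L ((B₁ \ X) \ (U ∪ T₁)) _ φ₄ hP4 (by
    rw [disjoint_union_right]
    refine ⟨sdiff_disjoint, disjoint_left.2 (fun z hz =>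
      dB z (mem_sdiff.1 (mem_sdiff.1 hz).1).1)⟩) (by
    intro x hx
    have hx' := hx
    simp only [mem_sdiff, mem_union, not_or] at hx'
    obtain ⟨⟨hxB, hxX⟩, hxU, hxT⟩ := hx'
    rw [hE5, hLn1 x hxB hxT]
    have h1 := dg_union_le (H := H) (B₁ \ X) B₂ x
    have h2 := hd1 x hxB
    have h3 := dg_lt_card (H := H) (mem_sdiff.2 ⟨hxB, hxX⟩)
    have h4 := card_sdiff_of_subset hXB
    omega)
  rw [hE5] at hP5
  -- step 6
  have hE6 : B₁ \ X ∪ B₂ ∪ X = B₁ ∪ B₂ := by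
    ext x
    simp only [mem_union, mem_sdiff]
    have a1 := @hXB x
    tauto
  have hs1 : ∀ v ∈ X, (killedSet C L (B₁ \ X ∪ B₂) φ₅ v).card + dg H B₂ v
      ≤ dg H (B₁ \ X ∪ B₂) v := by
    intro v hv
    refine saving_mono C L (φ := φ₀) (S := U ∪ W) ?_ ?_ (hsX v hv)
    · exact union_subset_union hU hWB
    · intro y hy
      have y1 : y ∈ U ∪ W ∪ T₂ := mem_union_left _ hy
      have y2 : y ∈ U ∪ B₂ \ Z := by rw [← hE2]; exact mem_union_left _ y1
      have y3 : y ∈ U ∪ B₂ := by rw [← hE3]; exact mem_union_left _ y2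
      have y4 : y ∈ U ∪ T₁ ∪ B₂ := by rw [← hE4]; exact mem_union_left _ y3
      rw [he5 y y4, he4 y y3, he3 y y2, he2 y y1, he1 y hy]
  obtain ⟨φ, hP, -⟩ := greedy C L (fun v => dg H B₂ v) X _ φ₅ hP5 (by
    rw [disjoint_union_right]
    exact ⟨disjoint_sdiff, disjoint_left.2 (fun z hz => dB z (hXB hz))⟩) hs1 (by
    intro x hx
    rw [hE6, hLn1 x (hXB hx) (hXT x hx)]
    have h1 := dg_union_le (H := H) B₁ B₂ x
    have h3 := dg_lt_card (H := H) (hXB hx)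
    omega)
  rw [hE6] at hP
  exact ⟨φ, fun v => mem_Icc.1 (hLf v (hP.1 v (hcover v))),
    fun u v _ => hP.2 u (hcover u) v (hcover v)⟩
end
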